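/- arXiv:2602.00358 — 3 statements merged into one kernel-verified Lean document; each statement's English description precedes it below -/
import Mathlib

section
/- Let 𝒜 be a unital C*-algebra, let a, b ∈ 𝒜 be positive elements, and let t ∈ (0,1). Then ‖a^t b^(1-t) + b^t a^(1-t)‖ ≤ 2^(max{2|t − 1/2| − 1/2, 0}) · ‖a + b‖. -/
/-- **Cauchy–Schwarz** for sums of two products in a C*-algebra. -/
theorem CStarAlgebra.norm_mul_add_mul_sq_le {A : Type*} [CStarAlgebra A]
    [PartialOrder A] [StarOrderedRing A] (p q x y : A) :
    ‖p * x + q * y‖ ^ 2 ≤ ‖p * star p + q * star q‖ * ‖star x * x + star y * y‖ := by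
  let u : WithCStarModule A (A × A) := (WithCStarModule.equiv A (A × A)).symm (star x, star y)
  let v : WithCStarModule A (A × A) := (WithCStarModule.equiv A (A × A)).symm (p, q)
  have h := CStarModule.norm_inner_le (A := A) (WithCStarModule A (A × A)) (x := u) (y := v)
  have huv : inner A u v = p * x + q * y := by
    simp [u, v, WithCStarModule.prod_inner, WithCStarModule.inner_def]
  have hu : ‖u‖ ^ 2 = ‖star x * x + star y * y‖ := by
    simp [u, CStarModule.norm_sq_eq A, WithCStarModule.prod_inner, WithCStarModule.inner_def]
  have hv : ‖v‖ ^ 2 = ‖p * star p + q * star q‖ := by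
    simp [v, CStarModule.norm_sq_eq A, WithCStarModule.prod_inner, WithCStarModule.inner_def]
  rw [huv] at h
  calc ‖p * x + q * y‖ ^ 2 ≤ (‖u‖ * ‖v‖) ^ 2 := by gcongr
    _ = _ := by rw [mul_pow, hu, hv, mul_comm]

/-- For nonnegative exponents, the exponent law needs no invertibility. -/
theorem CFC.rpow_mul_rpow_of_nonneg {A : Type*} [CStarAlgebra A]
    [PartialOrder A] [StarOrderedRing A] {a : A} (ha : 0 ≤ a) {r s : ℝ}
    (hr : 0 ≤ r) (hs : 0 ≤ s) : a ^ r * a ^ s = a ^ (r + s) := by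
  rw [CFC.rpow_eq_cfc_real ha, CFC.rpow_eq_cfc_real ha, CFC.rpow_eq_cfc_real ha,
    ← cfc_mul _ _ a (Real.continuous_rpow_const hr).continuousOn
      (Real.continuous_rpow_const hs).continuousOn]
  exact cfc_congr fun x hx =>
    (Real.rpow_add_of_nonneg (spectrum_nonneg_of_nonneg ha hx) hr hs).symm

/-- An affine majorant of `x ↦ x ^ (1 - s) * (M - x) ^ s` on `[0, M]` yields an operator bound for
`b ^ ((1 - s) / 2) * a ^ s * b ^ ((1 - s) / 2)` whenever `a + b ≤ M`. -/
theorem CFC.conjugate_rpow_le_affine {A : Type*} [CStarAlgebra A]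
    [PartialOrder A] [StarOrderedRing A] {a b : A} (ha : 0 ≤ a) (hb : 0 ≤ b) {M s α β : ℝ}
    (hs : s ∈ Set.Icc (0 : ℝ) 1) (hM : a + b ≤ algebraMap ℝ A M)
    (hbound : ∀ x ∈ Set.Icc 0 M, x ^ (1 - s) * (M - x) ^ s ≤ α + β * x) :
    b ^ ((1 - s) / 2) * a ^ s * b ^ ((1 - s) / 2) ≤ algebraMap ℝ A α + β • b := by
  have hs1 : 0 ≤ (1 - s) / 2 := by linarith [hs.2]
  have hbM : b ≤ algebraMap ℝ A M := (le_add_of_nonneg_left ha).trans hM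
  have hspec : ∀ x ∈ spectrum ℝ b, x ∈ Set.Icc 0 M := fun x hx =>
    ⟨spectrum_nonneg_of_nonneg hb hx, (le_algebraMap_iff_spectrum_le (ha := IsSelfAdjoint.of_nonneg hb)).1 hbM x hx⟩
  have hsub : algebraMap ℝ A M - b = cfc (fun x : ℝ => M - x) b := by
    rw [cfc_sub (fun _ => M) (fun x => x) b, cfc_const M b, cfc_id' ℝ b]
  have hpow : (algebraMap ℝ A M - b) ^ s = cfc (fun x : ℝ => (M - x) ^ s) b := by
    rw [CFC.rpow_eq_cfc_real (sub_nonneg.2 hbM), hsub,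
      ← cfc_comp' (fun x : ℝ => x ^ s) (fun x => M - x) b
        (Real.continuous_rpow_const hs.1).continuousOn]
  have hcont : Continuous fun x : ℝ => x ^ ((1 - s) / 2) := Real.continuous_rpow_const hs1
  have hcont' : Continuous fun x : ℝ => (M - x) ^ s :=
    (Real.continuous_rpow_const hs.1).comp (by fun_prop)
  calc b ^ ((1 - s) / 2) * a ^ s * b ^ ((1 - s) / 2)
      ≤ b ^ ((1 - s) / 2) * (algebraMap ℝ A M - b) ^ s * b ^ ((1 - s) / 2) :=
        conjugate_le_conjugate_of_nonneg
          (CFC.rpow_le_rpow hs (le_sub_iff_add_le.2 hM)) CFC.rpow_nonneg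
    _ = cfc (fun x : ℝ => x ^ ((1 - s) / 2) * (M - x) ^ s * x ^ ((1 - s) / 2)) b := by
        rw [hpow, CFC.rpow_eq_cfc_real hb, ← cfc_mul _ _ b hcont.continuousOn hcont'.continuousOn,
          ← cfc_mul (fun x : ℝ => x ^ ((1 - s) / 2) * (M - x) ^ s) _ b
            (hcont.mul hcont').continuousOn hcont.continuousOn]
    _ ≤ cfc (fun x : ℝ => α + β * x) b := by
        refine cfc_mono (fun x hx => ?_) ((hcont.mul hcont').mul hcont).continuousOn (by fun_prop)
        refine le_of_eq_of_le ?_ (hbound x (hspec x hx))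
        rw [mul_right_comm, ← Real.rpow_add_of_nonneg (hspec x hx).1 hs1 hs1, add_halves]
    _ = algebraMap ℝ A α + β • b := by
        rw [cfc_const_add α (fun x => β * x) b, cfc_const_mul β (fun x => x) b, cfc_id' ℝ b]

theorem Real.rpow_mul_sub_rpow_le_affine {M s x : ℝ} (hs : s ∈ Set.Icc (0 : ℝ) 1)
    (hx : x ∈ Set.Icc 0 M) : x ^ (1 - s) * (M - x) ^ s ≤ s * M + (1 - 2 * s) * x := by
  have h := Real.geom_mean_le_arith_mean2_weighted (sub_nonneg.2 hs.2) hs.1 hx.1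
    (sub_nonneg.2 hx.2) (by ring)
  linarith

theorem Real.rpow_mul_sub_rpow_le_const {M s x : ℝ} (hs : s ∈ Set.Icc (1 / 2 : ℝ) 1)
    (hx : x ∈ Set.Icc 0 M) : x ^ (1 - s) * (M - x) ^ s ≤ (2 : ℝ) ^ (2 * s - 2) * M := by
  have hMx : 0 ≤ M - x := sub_nonneg.2 hx.2
  have hM : 0 ≤ M := hx.1.trans hx.2
  have h1s : 0 ≤ 1 - s := sub_nonneg.2 hs.2
  have h2s : 0 ≤ 2 * s - 1 := by linarith [hs.1]
  calc x ^ (1 - s) * (M - x) ^ s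
      = (x * (M - x)) ^ (1 - s) * (M - x) ^ (2 * s - 1) := by
        rw [Real.mul_rpow hx.1 hMx, mul_assoc, ← Real.rpow_add_of_nonneg hMx h1s h2s]
        ring_nf
    _ ≤ ((M / 2) ^ (2 : ℝ)) ^ (1 - s) * M ^ (2 * s - 1) := by
        have : x * (M - x) ≤ (M / 2) ^ (2 : ℝ) := by
          rw [Real.rpow_two]; nlinarith [sq_nonneg (x - M / 2)]
        have : M - x ≤ M := by linarith [hx.1]
        have := mul_nonneg hx.1 hMx
        gcongr
    _ = (2 : ℝ) ^ (2 * s - 2) * M := by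
        rw [← Real.rpow_mul (by positivity), Real.div_rpow hM zero_le_two, div_mul_eq_mul_div,
          ← Real.rpow_add_of_nonneg hM (by positivity) h2s,
          show 2 * s - 2 = -(2 * (1 - s)) by ring, Real.rpow_neg zero_le_two]
        ring_nf
        simp [mul_comm]

/-- The column factor of the crossed Heinz sum has squared norm at most
`2 ^ (max (2 * s - 1) 0) * ‖a + b‖`. -/
theorem CFC.norm_conjugate_rpow_add_le {A : Type*} [CStarAlgebra A]
    [PartialOrder A] [StarOrderedRing A] {a b : A} (ha : 0 ≤ a) (hb : 0 ≤ b) {s : ℝ}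
    (hs : s ∈ Set.Icc (0 : ℝ) 1) :
    ‖b ^ ((1 - s) / 2) * a ^ s * b ^ ((1 - s) / 2) +
        a ^ ((1 - s) / 2) * b ^ s * a ^ ((1 - s) / 2)‖ ≤
      (2 : ℝ) ^ max (2 * s - 1) 0 * ‖a + b‖ := by
  have hM : a + b ≤ algebraMap ℝ A ‖a + b‖ :=
    IsSelfAdjoint.le_algebraMap_norm_self (IsSelfAdjoint.of_nonneg (add_nonneg ha hb))
  have hM' : b + a ≤ algebraMap ℝ A ‖a + b‖ := add_comm a b ▸ hM
  have hnonneg : 0 ≤ b ^ ((1 - s) / 2) * a ^ s * b ^ ((1 - s) / 2) +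
      a ^ ((1 - s) / 2) * b ^ s * a ^ ((1 - s) / 2) :=
    add_nonneg (conjugate_nonneg_of_nonneg CFC.rpow_nonneg CFC.rpow_nonneg)
      (conjugate_nonneg_of_nonneg CFC.rpow_nonneg CFC.rpow_nonneg)
  rw [CStarAlgebra.norm_le_iff_le_algebraMap _ (by positivity) hnonneg]
  rcases le_total s (1 / 2) with h | h
  · have key := fun x (hx : x ∈ Set.Icc 0 ‖a + b‖) => Real.rpow_mul_sub_rpow_le_affine hs hx
    rw [max_eq_right (by linarith), Real.rpow_zero, one_mul]
    calc _ ≤ _ := add_le_add (CFC.conjugate_rpow_le_affine ha hb hs hM key)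
          (CFC.conjugate_rpow_le_affine hb ha hs hM' key)
      _ = (2 * s) • algebraMap ℝ A ‖a + b‖ + (1 - 2 * s) • (a + b) := by
        simp only [Algebra.algebraMap_eq_smul_one]
        module
      _ ≤ (2 * s) • algebraMap ℝ A ‖a + b‖ + (1 - 2 * s) • algebraMap ℝ A ‖a + b‖ := by
        gcongr
        linarith
      _ = algebraMap ℝ A ‖a + b‖ := by module
  · have key : ∀ x ∈ Set.Icc 0 ‖a + b‖, x ^ (1 - s) * (‖a + b‖ - x) ^ s ≤
        (2 : ℝ) ^ (2 * s - 2) * ‖a + b‖ + 0 * x := fun x hx => by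
      simpa using Real.rpow_mul_sub_rpow_le_const ⟨h, hs.2⟩ hx
    rw [max_eq_left (by linarith)]
    calc _ ≤ _ := add_le_add (CFC.conjugate_rpow_le_affine ha hb hs hM key)
          (CFC.conjugate_rpow_le_affine hb ha hs hM' key)
      _ = algebraMap ℝ A ((2 : ℝ) ^ (2 * s - 1) * ‖a + b‖) := by
        rw [show 2 * s - 1 = 2 * s - 2 + 1 by ring, Real.rpow_add_one two_ne_zero]
        simp only [Algebra.algebraMap_eq_smul_one]
        module

/-- The crossed Heinz bound on the half-range `1 / 2 ≤ t ≤ 1`. -/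
theorem CFC.norm_crossed_heinz_le_of_half_le {A : Type*} [CStarAlgebra A]
    [PartialOrder A] [StarOrderedRing A] {a b : A} (ha : 0 ≤ a) (hb : 0 ≤ b) {t : ℝ}
    (ht : t ∈ Set.Icc (1 / 2 : ℝ) 1) :
    ‖a ^ t * b ^ (1 - t) + b ^ t * a ^ (1 - t)‖ ≤
      (2 : ℝ) ^ max (2 * (t - 1 / 2) - 1 / 2) 0 * ‖a + b‖ := by
  have ht' : 0 ≤ t - 1 / 2 := sub_nonneg.2 ht.1
  have hstar (c : A) (r : ℝ) : star (c ^ r) = c ^ r :=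
    (IsSelfAdjoint.of_nonneg CFC.rpow_nonneg).star_eq
  have hsplit {c : A} (hc : 0 ≤ c) : c ^ t = c ^ (1 / 2 : ℝ) * c ^ (t - 1 / 2) := by
    rw [CFC.rpow_mul_rpow_of_nonneg hc (by norm_num) ht', add_sub_cancel]
  have hrow {c : A} (hc : 0 ≤ c) : c ^ (1 / 2 : ℝ) * star (c ^ (1 / 2 : ℝ)) = c := by
    rw [hstar, CFC.rpow_mul_rpow_of_nonneg hc (by norm_num) (by norm_num), add_halves,
      CFC.rpow_one c hc]
  have hcol {c d : A} (hc : 0 ≤ c) :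
      star (c ^ (t - 1 / 2) * d ^ (1 - t)) * (c ^ (t - 1 / 2) * d ^ (1 - t)) =
        d ^ ((1 - (2 * t - 1)) / 2) * c ^ (2 * t - 1) * d ^ ((1 - (2 * t - 1)) / 2) := by
    rw [show (1 - (2 * t - 1)) / 2 = 1 - t by ring,
      show 2 * t - 1 = (t - 1 / 2) + (t - 1 / 2) by ring,
      ← CFC.rpow_mul_rpow_of_nonneg hc ht' ht', star_mul, hstar, hstar]
    simp only [mul_assoc]
  have hCS := CStarAlgebra.norm_mul_add_mul_sq_le (a ^ (1 / 2 : ℝ)) (b ^ (1 / 2 : ℝ))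
    (a ^ (t - 1 / 2) * b ^ (1 - t)) (b ^ (t - 1 / 2) * a ^ (1 - t))
  rw [← mul_assoc, ← mul_assoc, ← hsplit ha, ← hsplit hb, hrow ha, hrow hb, hcol ha,
    hcol hb] at hCS
  have hs : 2 * t - 1 ∈ Set.Icc (0 : ℝ) 1 := ⟨by linarith, by linarith [ht.2]⟩
  refine (sq_le_sq₀ (norm_nonneg _) (by positivity)).1 (hCS.trans ?_)
  calc _ ≤ ‖a + b‖ * ((2 : ℝ) ^ max (2 * (2 * t - 1) - 1) 0 * ‖a + b‖) := by
        gcongr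
        exact CFC.norm_conjugate_rpow_add_le ha hb hs
    _ = ((2 : ℝ) ^ max (2 * (t - 1 / 2) - 1 / 2) 0 * ‖a + b‖) ^ 2 := by
        have hmax : max (2 * (2 * t - 1) - 1) 0 = max (2 * (t - 1 / 2) - 1 / 2) 0 * 2 := by
          rw [max_mul_of_nonneg _ _ zero_le_two]
          ring_nf
        rw [hmax, Real.rpow_mul zero_le_two, Real.rpow_two]
        ring

/-- **Bourin-type bound in a unital C*-algebra (operator-norm case).**
For positive elements `a, b` of a unital C*-algebra and `t ∈ (0,1)`,
`‖a^t b^(1-t) + b^t a^(1-t)‖ ≤ 2^(max (2|t-1/2| - 1/2) 0) * ‖a + b‖`,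
where real powers are taken via the continuous functional calculus. -/
theorem crossed_heinz_bound_cstar {A : Type*} [CStarAlgebra A]
    [PartialOrder A] [StarOrderedRing A]
    (a b : A) (ha : 0 ≤ a) (hb : 0 ≤ b) (t : ℝ) (ht : t ∈ Set.Ioo (0 : ℝ) 1) :
    ‖CFC.rpow a t * CFC.rpow b (1 - t) + CFC.rpow b t * CFC.rpow a (1 - t)‖ ≤
      (2 : ℝ) ^ max (2 * |t - 1 / 2| - 1 / 2) (0 : ℝ) * ‖a + b‖ := by
  simp only [CFC.rpow_eq_pow]
  rcases le_total (1 / 2) t with h | h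
  · rw [abs_of_nonneg (sub_nonneg.2 h)]
    exact CFC.norm_crossed_heinz_le_of_half_le ha hb ⟨h, ht.2.le⟩
  · have hstar (c : A) (r : ℝ) : star (c ^ r) = c ^ r :=
      (IsSelfAdjoint.of_nonneg CFC.rpow_nonneg).star_eq
    have key := CFC.norm_crossed_heinz_le_of_half_le ha hb (t := 1 - t)
      ⟨by linarith, by linarith [ht.1]⟩
    rw [sub_sub_cancel] at key
    rw [← norm_star, star_add, star_mul, star_mul, hstar, hstar, hstar, hstar,
      abs_of_nonpos (sub_nonpos.2 h), show -(t - 1 / 2) = 1 - t - 1 / 2 by ring, add_comm]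
    exact key
end

section
/- Let A, B be n×n positive semidefinite complex matrices and let t ∈ (1/2, 1). Then ‖B^(1-t) A^(2t-1) B^(1-t) + A^(1-t) B^(2t-1) A^(1-t)‖_F ≤ 2^(max{4t − 3, 0}) · ‖A + B‖_F, where ‖·‖_F is the Frobenius norm. -/
open scoped ComplexOrder

/-- The real power `A ^ r` of a (positive semidefinite) matrix, defined via the
continuous functional calculus (equivalently, via the spectral decomposition). -/
noncomputable def matRpow {n : ℕ} (A : Matrix (Fin n) (Fin n) ℂ) (r : ℝ) :
    Matrix (Fin n) (Fin n) ℂ :=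
  cfc (fun x : ℝ => x ^ r) A

/-- The Frobenius (Hilbert–Schmidt) norm `‖M‖_F = (∑_{i,j} |M_{ij}|²)^{1/2}`. -/
noncomputable def frobeniusNorm' {n : ℕ} (M : Matrix (Fin n) (Fin n) ℂ) : ℝ :=
  Real.sqrt (∑ i, ∑ j, ‖M i j‖ ^ 2)

open Matrix

section FrobeniusNorm

variable {n : ℕ}

lemma frobeniusNorm'_nonneg (M : Matrix (Fin n) (Fin n) ℂ) : 0 ≤ frobeniusNorm' M :=
  Real.sqrt_nonneg _

lemma frobeniusNorm'_sq (M : Matrix (Fin n) (Fin n) ℂ) :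
    frobeniusNorm' M ^ 2 = ∑ i, ∑ j, ‖M i j‖ ^ 2 :=
  Real.sq_sqrt (by positivity)

lemma frobeniusNorm'_conjTranspose (M : Matrix (Fin n) (Fin n) ℂ) :
    frobeniusNorm' Mᴴ = frobeniusNorm' M := by
  unfold frobeniusNorm'
  rw [Finset.sum_comm]
  simp

lemma trace_conjTranspose_mul_self_eq_frobeniusNorm'_sq (M : Matrix (Fin n) (Fin n) ℂ) :
    (Mᴴ * M).trace = (frobeniusNorm' M ^ 2 : ℝ) := by
  rw [frobeniusNorm'_sq, Finset.sum_comm]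
  simp [trace, mul_apply, Complex.conj_mul']

lemma norm_trace_mul_le (M K : Matrix (Fin n) (Fin n) ℂ) :
    ‖(M * K).trace‖ ≤ frobeniusNorm' M * frobeniusNorm' K := by
  rw [← frobeniusNorm'_conjTranspose K]
  unfold frobeniusNorm'
  simp_rw [← Fintype.sum_prod_type']
  have h : (M * K).trace = ∑ p : Fin n × Fin n, M p.1 p.2 * K p.2 p.1 := by
    rw [Fintype.sum_prod_type]
    simp [trace, mul_apply]
  rw [h]
  refine (norm_sum_le _ _).trans ?_
  simp_rw [norm_mul, conjTranspose_apply, norm_star]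
  exact Real.sum_mul_le_sqrt_mul_sqrt _ _ _

lemma frobeniusNorm'_unitary_mul (U : unitaryGroup (Fin n) ℂ) (M : Matrix (Fin n) (Fin n) ℂ) :
    frobeniusNorm' ((U : Matrix (Fin n) (Fin n) ℂ) * M) = frobeniusNorm' M := by
  rw [← sq_eq_sq₀ (frobeniusNorm'_nonneg _) (frobeniusNorm'_nonneg _), ← Complex.ofReal_inj,
    ← trace_conjTranspose_mul_self_eq_frobeniusNorm'_sq,
    ← trace_conjTranspose_mul_self_eq_frobeniusNorm'_sq, conjTranspose_mul, Matrix.mul_assoc,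
    ← Matrix.mul_assoc _ (U : Matrix (Fin n) (Fin n) ℂ), ← star_eq_conjTranspose U.1,
    UnitaryGroup.star_mul_self, Matrix.one_mul]

lemma frobeniusNorm'_mul_unitary (U : unitaryGroup (Fin n) ℂ) (M : Matrix (Fin n) (Fin n) ℂ) :
    frobeniusNorm' (M * (U : Matrix (Fin n) (Fin n) ℂ)) = frobeniusNorm' M := by
  rw [← frobeniusNorm'_conjTranspose, conjTranspose_mul]
  exact (frobeniusNorm'_unitary_mul (star U) _).trans (frobeniusNorm'_conjTranspose M)

lemma frobeniusNorm'_diagonal_mul_le {d : Fin n → ℂ} {c : ℝ} (hc : 0 ≤ c) (hd : ∀ i, ‖d i‖ ≤ c)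
    (M : Matrix (Fin n) (Fin n) ℂ) :
    frobeniusNorm' (diagonal d * M) ≤ c * frobeniusNorm' M := by
  have := frobeniusNorm'_nonneg M
  rw [← sq_le_sq₀ (frobeniusNorm'_nonneg _) (by positivity), mul_pow, frobeniusNorm'_sq,
    frobeniusNorm'_sq, Finset.mul_sum]
  refine Finset.sum_le_sum fun i _ => ?_
  rw [Finset.mul_sum]
  refine Finset.sum_le_sum fun j _ => ?_
  rw [diagonal_mul, norm_mul, mul_pow]
  gcongr
  exact hd i

lemma frobeniusNorm'_add_sq {M K : Matrix (Fin n) (Fin n) ℂ} (hM : M.IsHermitian)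
    (hK : K.IsHermitian) :
    frobeniusNorm' (M + K) ^ 2 =
      frobeniusNorm' M ^ 2 + frobeniusNorm' K ^ 2 + 2 * (M * K).trace.re := by
  have h (L : Matrix (Fin n) (Fin n) ℂ) : frobeniusNorm' L ^ 2 = (Lᴴ * L).trace.re := by
    rw [trace_conjTranspose_mul_self_eq_frobeniusNorm'_sq, Complex.ofReal_re]
  rw [h, h M, h K, conjTranspose_add, hM.eq, hK.eq, Matrix.add_mul, Matrix.mul_add, Matrix.mul_add,
    trace_add, trace_add, trace_add, trace_mul_comm K M]
  simp only [Complex.add_re]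
  ring

end FrobeniusNorm

/-- The function `z ↦ x ^ z` for `x ≥ 0`, with the value `0` at `x = 0` for every `z`, so that it
is entire in `z`. -/
noncomputable def entireCPow (x : ℝ) (z : ℂ) : ℂ :=
  if x = 0 then 0 else Complex.exp (z * Real.log x)

lemma entireCPow_add (x : ℝ) (z w : ℂ) :
    entireCPow x (z + w) = entireCPow x z * entireCPow x w := by
  unfold entireCPow
  split_ifs
  · simp
  · rw [add_mul, Complex.exp_add]

lemma star_entireCPow (x : ℝ) (z : ℂ) : star (entireCPow x z) = entireCPow x (star z) := by
  unfold entireCPow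
  split_ifs
  · simp
  · simp [← Complex.exp_conj]

lemma differentiable_entireCPow (x : ℝ) : Differentiable ℂ (entireCPow x) := by
  unfold entireCPow
  split_ifs <;> fun_prop

lemma norm_entireCPow_le (x : ℝ) (z : ℂ) :
    ‖entireCPow x z‖ ≤ Real.exp (z.re * Real.log x) := by
  unfold entireCPow
  split_ifs
  · simpa using Real.exp_nonneg _
  · simp [Complex.norm_exp]

lemma entireCPow_ofReal {x : ℝ} (hx : 0 ≤ x) {r : ℝ} (hr : r ≠ 0) :
    entireCPow x r = (x ^ r : ℝ) := by
  unfold entireCPow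
  split_ifs with h
  · simp [h, Real.zero_rpow hr]
  · rw [Real.rpow_def_of_pos (lt_of_le_of_ne hx (Ne.symm h))]
    push_cast
    rw [mul_comm]

section SpectralCPow

variable {n : ℕ}

/-- The complex power `z ↦ A ^ z` of `A = U diag(a) U⁻¹`, taken on the range of `A` and extended by
zero on its kernel. -/
noncomputable def spectralCPow (U : unitaryGroup (Fin n) ℂ) (a : Fin n → ℝ) (z : ℂ) :
    Matrix (Fin n) (Fin n) ℂ :=
  (U : Matrix (Fin n) (Fin n) ℂ) * diagonal (fun i => entireCPow (a i) z) *
    (star U : unitaryGroup (Fin n) ℂ)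

variable (U V : unitaryGroup (Fin n) ℂ) (a b : Fin n → ℝ)

lemma spectralCPow_add (z w : ℂ) :
    spectralCPow U a (z + w) = spectralCPow U a z * spectralCPow U a w := by
  unfold spectralCPow
  simp only [entireCPow_add, ← diagonal_mul_diagonal, Matrix.mul_assoc]
  rw [← Matrix.mul_assoc (star U : unitaryGroup (Fin n) ℂ).1 U.1, ← UnitaryGroup.mul_val,
    Unitary.star_mul_self, UnitaryGroup.one_val, Matrix.one_mul]

lemma conjTranspose_spectralCPow (z : ℂ) :
    (spectralCPow U a z)ᴴ = spectralCPow U a (star z) := by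
  unfold spectralCPow
  simp only [conjTranspose_mul, diagonal_conjTranspose, ← star_entireCPow, Matrix.mul_assoc]
  simp [star_eq_conjTranspose, Pi.star_def]

lemma isHermitian_spectralCPow (r : ℝ) : (spectralCPow U a r).IsHermitian := by
  rw [Matrix.IsHermitian, conjTranspose_spectralCPow]
  simp

lemma differentiable_spectralCPow_apply (i j : Fin n) :
    Differentiable ℂ fun z => spectralCPow U a z i j := by
  simp only [spectralCPow, mul_apply (M := _ * _), mul_diagonal]
  have := fun k => differentiable_entireCPow (a k)
  fun_prop

lemma frobeniusNorm'_spectralCPow_mul_le {c : ℝ} (hc : 0 ≤ c) {z : ℂ}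
    (hz : ∀ i, ‖entireCPow (a i) z‖ ≤ c) (M : Matrix (Fin n) (Fin n) ℂ) :
    frobeniusNorm' (spectralCPow U a z * M) ≤ c * frobeniusNorm' M := by
  unfold spectralCPow
  rw [Matrix.mul_assoc, Matrix.mul_assoc, frobeniusNorm'_unitary_mul]
  refine (frobeniusNorm'_diagonal_mul_le hc hz _).trans_eq ?_
  rw [frobeniusNorm'_unitary_mul]

lemma frobeniusNorm'_spectralCPow_mul_le_of_re_eq_zero {z : ℂ} (hz : z.re = 0)
    (M : Matrix (Fin n) (Fin n) ℂ) :
    frobeniusNorm' (spectralCPow U a z * M) ≤ frobeniusNorm' M := by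
  simpa using frobeniusNorm'_spectralCPow_mul_le U a zero_le_one
    (fun i => by simpa [hz] using norm_entireCPow_le (a i) z) M

lemma frobeniusNorm'_mul_spectralCPow_le_of_re_eq_zero {z : ℂ} (hz : z.re = 0)
    (M : Matrix (Fin n) (Fin n) ℂ) :
    frobeniusNorm' (M * spectralCPow U a z) ≤ frobeniusNorm' M := by
  rw [← frobeniusNorm'_conjTranspose, conjTranspose_mul, conjTranspose_spectralCPow,
    ← frobeniusNorm'_conjTranspose M]
  exact frobeniusNorm'_spectralCPow_mul_le_of_re_eq_zero U a (by simpa using hz) _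

lemma exists_frobeniusNorm'_spectralCPow_mul_le :
    ∃ c : ℝ, 0 ≤ c ∧ ∀ z : ℂ, 0 ≤ z.re → z.re ≤ 1 → ∀ M : Matrix (Fin n) (Fin n) ℂ,
      frobeniusNorm' (spectralCPow U a z * M) ≤ c * frobeniusNorm' M := by
  refine ⟨∑ i, Real.exp |Real.log (a i)|, by positivity, fun z h0 h1 M =>
    frobeniusNorm'_spectralCPow_mul_le U a (by positivity) (fun i => ?_) M⟩
  refine (norm_entireCPow_le _ _).trans ?_
  refine le_trans ?_ (Finset.single_le_sum (f := fun i => Real.exp |Real.log (a i)|)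
    (fun i _ => Real.exp_nonneg _) (Finset.mem_univ i))
  rw [Real.exp_le_exp]
  calc z.re * Real.log (a i) ≤ z.re * |Real.log (a i)| := by gcongr; exact le_abs_self _
    _ ≤ 1 * |Real.log (a i)| := by gcongr
    _ = _ := one_mul _

lemma frobeniusNorm'_spectralCPow_mul_spectralCPow_sq (z w : ℂ) :
    frobeniusNorm' (spectralCPow U a z * spectralCPow V b w) ^ 2 =
      ∑ i, ∑ j, ‖entireCPow (a i) z‖ ^ 2 * ‖entireCPow (b j) w‖ ^ 2 *
        ‖(star U * V : unitaryGroup (Fin n) ℂ).1 i j‖ ^ 2 := by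
  have h : spectralCPow U a z * spectralCPow V b w =
      U.1 * (diagonal (fun i => entireCPow (a i) z) * (star U * V : unitaryGroup (Fin n) ℂ).1 *
        diagonal (fun i => entireCPow (b i) w)) * (star V : unitaryGroup (Fin n) ℂ).1 := by
    simp only [spectralCPow, Matrix.mul_assoc, UnitaryGroup.mul_val]
  rw [h, frobeniusNorm'_mul_unitary, frobeniusNorm'_unitary_mul, frobeniusNorm'_sq]
  simp only [mul_diagonal, diagonal_mul, norm_mul, mul_pow]
  refine Finset.sum_congr rfl fun i _ => Finset.sum_congr rfl fun j _ => ?_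
  ring

lemma frobeniusNorm'_spectralCPow_sq_left (z : ℂ) :
    frobeniusNorm' (spectralCPow U a z) ^ 2 =
      ∑ i, ∑ j, ‖entireCPow (a i) z‖ ^ 2 *
        ‖(star U * V : unitaryGroup (Fin n) ℂ).1 i j‖ ^ 2 := by
  rw [← frobeniusNorm'_mul_unitary V]
  have h : spectralCPow U a z * V.1 =
      U.1 * (diagonal (fun i => entireCPow (a i) z) * (star U * V : unitaryGroup (Fin n) ℂ).1) := by
    simp only [spectralCPow, Matrix.mul_assoc, UnitaryGroup.mul_val]
  rw [h, frobeniusNorm'_unitary_mul, frobeniusNorm'_sq]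
  simp only [diagonal_mul, norm_mul, mul_pow]

lemma frobeniusNorm'_spectralCPow_sq_right (w : ℂ) :
    frobeniusNorm' (spectralCPow V b w) ^ 2 =
      ∑ i, ∑ j, ‖entireCPow (b j) w‖ ^ 2 *
        ‖(star U * V : unitaryGroup (Fin n) ℂ).1 i j‖ ^ 2 := by
  rw [← frobeniusNorm'_unitary_mul (star U)]
  have h : (star U : unitaryGroup (Fin n) ℂ).1 * spectralCPow V b w =
      (star U * V : unitaryGroup (Fin n) ℂ).1 * diagonal (fun i => entireCPow (b i) w) *
        (star V : unitaryGroup (Fin n) ℂ).1 := by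
    simp only [spectralCPow, Matrix.mul_assoc, UnitaryGroup.mul_val]
  rw [h, frobeniusNorm'_mul_unitary, frobeniusNorm'_sq]
  simp only [mul_diagonal, norm_mul, mul_pow, mul_comm]

end SpectralCPow

section Interpolation

variable {n : ℕ}

lemma frobeniusNorm'_mul_mul_self_le {X Y : Matrix (Fin n) (Fin n) ℂ} (hX : X.IsHermitian)
    (hY : Y.IsHermitian) : frobeniusNorm' (Y * X * Y) ≤ frobeniusNorm' (X * (Y * Y)) := by
  rw [← sq_le_sq₀ (frobeniusNorm'_nonneg _) (frobeniusNorm'_nonneg _)]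
  calc frobeniusNorm' (Y * X * Y) ^ 2
      = ‖((Y * X * Y)ᴴ * (Y * X * Y)).trace‖ := by
        rw [trace_conjTranspose_mul_self_eq_frobeniusNorm'_sq, Complex.norm_real,
          Real.norm_of_nonneg (sq_nonneg _)]
    _ = ‖(X * (Y * Y) * (X * (Y * Y))).trace‖ := by
        rw [conjTranspose_mul, conjTranspose_mul, hX.eq, hY.eq, Matrix.mul_assoc, trace_mul_comm]
        simp only [Matrix.mul_assoc]
    _ ≤ frobeniusNorm' (X * (Y * Y)) ^ 2 := by
        rw [sq]
        exact norm_trace_mul_le _ _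

lemma frobeniusNorm'_mul_mul_conjTranspose_le {C K : Matrix (Fin n) (Fin n) ℂ}
    (hK : frobeniusNorm' (Cᴴ * C * K) ≤ frobeniusNorm' (Cᴴ * C))
    (hK' : frobeniusNorm' (Cᴴ * C * Kᴴ) ≤ frobeniusNorm' (Cᴴ * C)) :
    frobeniusNorm' (C * K * Cᴴ) ≤ frobeniusNorm' (Cᴴ * C) := by
  have h0 := frobeniusNorm'_nonneg (Cᴴ * C)
  rw [← sq_le_sq₀ (frobeniusNorm'_nonneg _) h0]
  calc frobeniusNorm' (C * K * Cᴴ) ^ 2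
      = ‖((C * K * Cᴴ)ᴴ * (C * K * Cᴴ)).trace‖ := by
        rw [trace_conjTranspose_mul_self_eq_frobeniusNorm'_sq, Complex.norm_real,
          Real.norm_of_nonneg (sq_nonneg _)]
    _ = ‖((Cᴴ * C * Kᴴ) * (Cᴴ * C * K)).trace‖ := by
        rw [conjTranspose_mul, conjTranspose_mul, conjTranspose_conjTranspose,
          ← Matrix.mul_assoc, trace_mul_comm]
        simp only [Matrix.mul_assoc]
    _ ≤ frobeniusNorm' (Cᴴ * C * Kᴴ) * frobeniusNorm' (Cᴴ * C * K) := norm_trace_mul_le _ _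
    _ ≤ frobeniusNorm' (Cᴴ * C) ^ 2 := by
        rw [sq]
        exact mul_le_mul hK' hK (frobeniusNorm'_nonneg _) h0

variable (U V : unitaryGroup (Fin n) ℂ) (a b : Fin n → ℝ)

lemma frobeniusNorm'_spectralCPow_mul_comm (r s : ℝ) :
    frobeniusNorm' (spectralCPow V b r * spectralCPow U a s) =
      frobeniusNorm' (spectralCPow U a s * spectralCPow V b r) := by
  rw [← frobeniusNorm'_conjTranspose, conjTranspose_mul, isHermitian_spectralCPow,
    isHermitian_spectralCPow]

lemma frobeniusNorm'_spectralCPow_mul_sq_le {u : ℝ} (h0 : 0 ≤ u) (h1 : u ≤ 1) :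
    frobeniusNorm' (spectralCPow U a u * spectralCPow V b (1 - u : ℝ)) ^ 2 ≤
      u * frobeniusNorm' (spectralCPow U a 1) ^ 2 +
        (1 - u) * frobeniusNorm' (spectralCPow V b 1) ^ 2 := by
  rw [frobeniusNorm'_spectralCPow_mul_spectralCPow_sq, frobeniusNorm'_spectralCPow_sq_left U V,
    frobeniusNorm'_spectralCPow_sq_right U V, Finset.mul_sum, Finset.mul_sum,
    ← Finset.sum_add_distrib]
  refine Finset.sum_le_sum fun i _ => ?_
  rw [Finset.mul_sum, Finset.mul_sum, ← Finset.sum_add_distrib]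
  refine Finset.sum_le_sum fun j _ => ?_
  rw [← mul_assoc, ← mul_assoc, ← add_mul]
  gcongr
  have key (x : ℝ) (r : ℝ) : ‖entireCPow x r‖ ^ 2 ≤ (‖entireCPow x 1‖ ^ 2) ^ r := by
    unfold entireCPow
    split_ifs
    · simpa using Real.rpow_nonneg le_rfl r
    · simp only [Complex.norm_exp, ← Real.exp_nat_mul, ← Real.exp_mul]
      simp [mul_comm, mul_left_comm]
  calc _ ≤ (‖entireCPow (a i) 1‖ ^ 2) ^ u * (‖entireCPow (b j) 1‖ ^ 2) ^ (1 - u) := by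
        gcongr
        · exact key _ _
        · exact key _ _
    _ ≤ _ := Real.geom_mean_le_arith_mean2_weighted h0 (by linarith) (by positivity)
        (by positivity) (by ring)

/-- The factor `B ^ (1 - z) * A ^ (2z - 1) * B ^ (1 - z)` with complex exponents. -/
noncomputable def sandwichCPow (z : ℂ) : Matrix (Fin n) (Fin n) ℂ :=
  spectralCPow V b (1 - z) * spectralCPow U a (2 * z - 1) * spectralCPow V b (1 - z)

lemma isHermitian_sandwichCPow (t : ℝ) : (sandwichCPow U V a b t).IsHermitian := by
  simp [Matrix.IsHermitian, sandwichCPow, conjTranspose_mul, conjTranspose_spectralCPow,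
    Matrix.mul_assoc]

lemma frobeniusNorm'_sandwichCPow_sq_le {t : ℝ} (h0 : 1 / 2 ≤ t) (h1 : t ≤ 1) :
    frobeniusNorm' (sandwichCPow U V a b t) ^ 2 ≤
      (2 * t - 1) * frobeniusNorm' (spectralCPow U a 1) ^ 2 +
        (2 - 2 * t) * frobeniusNorm' (spectralCPow V b 1) ^ 2 := by
  have h := frobeniusNorm'_spectralCPow_mul_sq_le U V a b (u := 2 * t - 1) (by linarith)
    (by linarith)
  have h' := frobeniusNorm'_mul_mul_self_le (isHermitian_spectralCPow U a (2 * t - 1))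
    (isHermitian_spectralCPow V b (1 - t))
  rw [← spectralCPow_add, ← Complex.ofReal_add,
    show 1 - t + (1 - t) = 1 - (2 * t - 1) by ring] at h'
  rw [show 2 - 2 * t = 1 - (2 * t - 1) by ring]
  refine le_trans ?_ h
  have e : sandwichCPow U V a b t = spectralCPow V b (1 - t : ℝ) *
      spectralCPow U a (2 * t - 1 : ℝ) * spectralCPow V b (1 - t : ℝ) := by
    simp [sandwichCPow]
  rw [e]
  exact pow_le_pow_left₀ (frobeniusNorm'_nonneg _) h' 2

lemma frobeniusNorm'_sandwichCPow_le_of_re_eq_one {z : ℂ} (hz : z.re = 1) :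
    frobeniusNorm' (sandwichCPow U V a b z) ≤ frobeniusNorm' (spectralCPow U a 1) := by
  refine (frobeniusNorm'_mul_spectralCPow_le_of_re_eq_zero V b (by simp [hz]) _).trans ?_
  refine (frobeniusNorm'_spectralCPow_mul_le_of_re_eq_zero V b (by simp [hz]) _).trans ?_
  rw [show 2 * z - 1 = (2 * z - 2) + 1 by ring, spectralCPow_add]
  exact frobeniusNorm'_spectralCPow_mul_le_of_re_eq_zero U a (by simp [hz]) _

lemma frobeniusNorm'_sandwichCPow_le_of_re_eq_three_quarters {z : ℂ} (hz : z.re = 3 / 4) :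
    frobeniusNorm' (sandwichCPow U V a b z) ≤
      frobeniusNorm' (spectralCPow U a (1 / 2 : ℝ) * spectralCPow V b (1 / 2 : ℝ)) := by
  set w : ℂ := 3 / 4 - z with hw
  have hw0 : w.re = 0 := by simp [hw, hz]
  set q : ℂ := ((1 / 4 : ℝ) : ℂ) with hq
  have hqq : q + q = ((1 / 2 : ℝ) : ℂ) := by rw [hq]; push_cast; ring
  have e1 : 1 - z = w + q := by rw [hw, hq]; push_cast; ring
  have e1' : 1 - z = q + w := by rw [e1, add_comm]
  have e2 : 2 * z - 1 = q + (-2 * w) + q := by rw [hw, hq]; push_cast; ring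
  have hPh := isHermitian_spectralCPow U a (1 / 4)
  have hQh := isHermitian_spectralCPow V b (1 / 4)
  set C := spectralCPow V b q * spectralCPow U a q with hC
  have hCt : Cᴴ = spectralCPow U a q * spectralCPow V b q := by
    rw [hC, conjTranspose_mul, hPh.eq, hQh.eq]
  have e : sandwichCPow U V a b z =
      spectralCPow V b w * ((C * spectralCPow U a (-2 * w) * Cᴴ) * spectralCPow V b w) := by
    rw [sandwichCPow, e2]
    nth_rewrite 1 [e1]
    rw [e1', hCt, hC]
    simp only [spectralCPow_add, Matrix.mul_assoc]
  rw [e]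
  refine (frobeniusNorm'_spectralCPow_mul_le_of_re_eq_zero V b hw0 _).trans ?_
  refine (frobeniusNorm'_mul_spectralCPow_le_of_re_eq_zero V b hw0 _).trans ?_
  refine (frobeniusNorm'_mul_mul_conjTranspose_le
    (frobeniusNorm'_mul_spectralCPow_le_of_re_eq_zero U a (by simp [hw0]) _) ?_).trans ?_
  · rw [conjTranspose_spectralCPow]
    exact frobeniusNorm'_mul_spectralCPow_le_of_re_eq_zero U a (by simp [hw0]) _
  · have h : Cᴴ * C =
        spectralCPow U a q * spectralCPow V b (1 / 2 : ℝ) * spectralCPow U a q := by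
      rw [hCt, hC, ← hqq, spectralCPow_add]
      simp only [Matrix.mul_assoc]
    rw [h]
    refine (frobeniusNorm'_mul_mul_self_le (isHermitian_spectralCPow V b _) hPh).trans_eq ?_
    rw [← spectralCPow_add, hqq, frobeniusNorm'_spectralCPow_mul_comm]

lemma norm_trace_sandwichCPow_le_of_re_eq_one {z : ℂ} (hz : z.re = 1) :
    ‖(sandwichCPow U V a b z * sandwichCPow V U b a z).trace‖ ≤
      frobeniusNorm' (spectralCPow U a 1) * frobeniusNorm' (spectralCPow V b 1) :=
  (norm_trace_mul_le _ _).trans <| mul_le_mul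
    (frobeniusNorm'_sandwichCPow_le_of_re_eq_one U V a b hz)
    (frobeniusNorm'_sandwichCPow_le_of_re_eq_one V U b a hz)
    (frobeniusNorm'_nonneg _) (frobeniusNorm'_nonneg _)

lemma norm_trace_sandwichCPow_le_of_re_eq_three_quarters {z : ℂ} (hz : z.re = 3 / 4) :
    ‖(sandwichCPow U V a b z * sandwichCPow V U b a z).trace‖ ≤
      frobeniusNorm' (spectralCPow U a (1 / 2 : ℝ) * spectralCPow V b (1 / 2 : ℝ)) ^ 2 := by
  rw [sq]
  refine (norm_trace_mul_le _ _).trans <| mul_le_mul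
    (frobeniusNorm'_sandwichCPow_le_of_re_eq_three_quarters U V a b hz) ?_
    (frobeniusNorm'_nonneg _) (frobeniusNorm'_nonneg _)
  rw [← frobeniusNorm'_spectralCPow_mul_comm]
  exact frobeniusNorm'_sandwichCPow_le_of_re_eq_three_quarters V U b a hz

lemma norm_trace_sandwichCPow_le_of_re_eq_half {z : ℂ} (hz : z.re = 1 / 2) :
    ‖(sandwichCPow U V a b z * sandwichCPow V U b a z).trace‖ ≤
      frobeniusNorm' (spectralCPow U a (1 / 2 : ℝ) * spectralCPow V b (1 / 2 : ℝ)) ^ 2 := by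
  set w : ℂ := 1 / 2 - z with hw
  have hw0 : w.re = 0 := by simp [hw, hz]
  have hz0 : (2 * z - 1).re = 0 := by simp [hz]
  set q : ℂ := ((1 / 2 : ℝ) : ℂ) with hq
  have e1 : 1 - z = w + q := by rw [hw, hq]; push_cast; ring
  have e1' : 1 - z = q + w := by rw [e1, add_comm]
  have key (U V : unitaryGroup (Fin n) ℂ) (a b : Fin n → ℝ) :
      frobeniusNorm' (spectralCPow U a (1 - z) * spectralCPow V b (1 - z) *
        spectralCPow U a (2 * z - 1)) ≤
        frobeniusNorm' (spectralCPow U a q * spectralCPow V b q) := by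
    refine (frobeniusNorm'_mul_spectralCPow_le_of_re_eq_zero U a hz0 _).trans ?_
    nth_rewrite 1 [e1]
    rw [e1', spectralCPow_add, spectralCPow_add, Matrix.mul_assoc]
    refine (frobeniusNorm'_spectralCPow_mul_le_of_re_eq_zero U a hw0 _).trans ?_
    rw [← Matrix.mul_assoc]
    exact frobeniusNorm'_mul_spectralCPow_le_of_re_eq_zero V b hw0 _
  have e : (sandwichCPow U V a b z * sandwichCPow V U b a z).trace =
      ((spectralCPow U a (1 - z) * spectralCPow V b (1 - z) * spectralCPow U a (2 * z - 1)) *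
        (spectralCPow V b (1 - z) * spectralCPow U a (1 - z) *
          spectralCPow V b (2 * z - 1))).trace := by
    rw [sandwichCPow, sandwichCPow, ← Matrix.mul_assoc, trace_mul_comm]
    simp only [Matrix.mul_assoc]
  rw [e, sq]
  refine (norm_trace_mul_le _ _).trans <| mul_le_mul (key U V a b) ?_
    (frobeniusNorm'_nonneg _) (frobeniusNorm'_nonneg _)
  rw [← frobeniusNorm'_spectralCPow_mul_comm]
  exact key V U b a

lemma differentiable_mul_apply {F G : ℂ → Matrix (Fin n) (Fin n) ℂ}
    (hF : ∀ i j, Differentiable ℂ fun z => F z i j)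
    (hG : ∀ i j, Differentiable ℂ fun z => G z i j) (i j : Fin n) :
    Differentiable ℂ fun z => (F z * G z) i j := by
  simp only [mul_apply]
  fun_prop

lemma differentiable_sandwichCPow_apply (i j : Fin n) :
    Differentiable ℂ fun z => sandwichCPow U V a b z i j := by
  have hQ (i j) : Differentiable ℂ fun z => spectralCPow V b (1 - z) i j :=
    (differentiable_spectralCPow_apply V b i j).comp (g := fun z => spectralCPow V b z i j)
      (f := fun z => 1 - z) (by fun_prop)
  have hP (i j) : Differentiable ℂ fun z => spectralCPow U a (2 * z - 1) i j :=
    (differentiable_spectralCPow_apply U a i j).comp (g := fun z => spectralCPow U a z i j)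
      (f := fun z => 2 * z - 1) (by fun_prop)
  exact differentiable_mul_apply (differentiable_mul_apply hQ hP) hQ i j

lemma differentiable_trace_sandwichCPow :
    Differentiable ℂ fun z => (sandwichCPow U V a b z * sandwichCPow V U b a z).trace := by
  have h := differentiable_mul_apply (F := sandwichCPow U V a b) (G := sandwichCPow V U b a)
    (differentiable_sandwichCPow_apply U V a b) (differentiable_sandwichCPow_apply V U b a)
  simp only [trace, diag]
  exact Differentiable.fun_sum fun i _ => h i i

lemma exists_frobeniusNorm'_sandwichCPow_le :
    ∃ c : ℝ, ∀ z : ℂ, 1 / 2 ≤ z.re → z.re ≤ 1 → frobeniusNorm' (sandwichCPow U V a b z) ≤ c := by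
  obtain ⟨c, hc, h⟩ := exists_frobeniusNorm'_spectralCPow_mul_le U a
  obtain ⟨d, hd, h'⟩ := exists_frobeniusNorm'_spectralCPow_mul_le V b
  refine ⟨d * (c * (d * frobeniusNorm' (1 : Matrix (Fin n) (Fin n) ℂ))), fun z h0 h1 => ?_⟩
  have hz : 0 ≤ (1 - z).re ∧ (1 - z).re ≤ 1 := by
    simp only [Complex.sub_re, Complex.one_re]
    constructor <;> linarith
  have hz' : 0 ≤ (2 * z - 1).re ∧ (2 * z - 1).re ≤ 1 := by
    simp only [Complex.sub_re, Complex.one_re, Complex.mul_re, Complex.re_ofNat,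
      Complex.im_ofNat]
    constructor <;> linarith
  rw [sandwichCPow, Matrix.mul_assoc]
  refine (h' _ hz.1 hz.2 _).trans (mul_le_mul_of_nonneg_left ?_ hd)
  refine (h _ hz'.1 hz'.2 _).trans (mul_le_mul_of_nonneg_left ?_ hc)
  simpa using h' _ hz.1 hz.2 1

lemma norm_trace_sandwichCPow_le_interp {l u α β t : ℝ} (hl : 1 / 2 ≤ l) (hlu : l < u)
    (hu : u ≤ 1) (ht : t ∈ Set.Icc l u)
    (hα : ∀ z : ℂ, z.re = l → ‖(sandwichCPow U V a b z * sandwichCPow V U b a z).trace‖ ≤ α)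
    (hβ : ∀ z : ℂ, z.re = u → ‖(sandwichCPow U V a b z * sandwichCPow V U b a z).trace‖ ≤ β) :
    ‖(sandwichCPow U V a b t * sandwichCPow V U b a t).trace‖ ≤
      α ^ (1 - (t - l) / (u - l)) * β ^ ((t - l) / (u - l)) := by
  obtain ⟨c, hc⟩ := exists_frobeniusNorm'_sandwichCPow_le U V a b
  obtain ⟨d, hd⟩ := exists_frobeniusNorm'_sandwichCPow_le V U b a
  refine Complex.HadamardThreeLines.norm_le_interp_of_mem_verticalClosedStrip' (z := (t : ℂ))
    (f := fun z => (sandwichCPow U V a b z * sandwichCPow V U b a z).trace) hlu ht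
    (differentiable_trace_sandwichCPow U V a b).diffContOnCl ?_ hα hβ
  refine ⟨c * d, ?_⟩
  rintro _ ⟨z, hz, rfl⟩
  have h0 := hl.trans hz.1
  have h1 := hz.2.trans hu
  exact (norm_trace_mul_le _ _).trans <| mul_le_mul (hc z h0 h1) (hd z h0 h1)
    (frobeniusNorm'_nonneg _) ((frobeniusNorm'_nonneg _).trans (hc z h0 h1))

end Interpolation

lemma add_rpow_mul_rpow_le {S P θ : ℝ} (hS : 0 ≤ S) (hP : 0 ≤ P) (h0 : 0 < θ) (h1 : θ < 1) :
    S + P ^ (1 - θ) * S ^ θ ≤ (2 ^ θ) ^ 2 * (S + P) := by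
  have h2 : (1 : ℝ) ≤ 2 ^ θ := Real.one_le_rpow one_le_two h0.le
  have e : S = S ^ (1 - θ) * S ^ θ := by
    rw [← Real.rpow_add' hS (by simp)]
    simp
  have hle : S ^ (1 - θ) + P ^ (1 - θ) ≤ 2 ^ θ * (S + P) ^ (1 - θ) := by
    have h := (Real.concaveOn_rpow (p := 1 - θ) (by linarith) (by linarith)).2 hS hP
      one_half_pos.le one_half_pos.le (add_halves 1)
    simp only [smul_eq_mul] at h
    have h2 : (1 / 2 : ℝ) ^ (1 - θ) = 2 ^ θ / 2 := by
      rw [one_div, Real.inv_rpow zero_le_two, Real.rpow_sub zero_lt_two, Real.rpow_one, inv_div]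
    rw [← mul_add, ← mul_add, Real.mul_rpow (by norm_num) (by positivity), h2] at h
    linarith
  calc S + P ^ (1 - θ) * S ^ θ = (S ^ (1 - θ) + P ^ (1 - θ)) * S ^ θ := by
        rw [add_mul, ← e]
    _ ≤ (2 ^ θ * (S + P) ^ (1 - θ)) * (S + P) ^ θ := by
        gcongr
        linarith
    _ = 2 ^ θ * (S + P) := by
        rw [mul_assoc, ← Real.rpow_add' (by positivity) (by simp)]
        simp
    _ ≤ (2 ^ θ) ^ 2 * (S + P) := by
        gcongr
        nlinarith

lemma frobeniusNorm'_sandwichCPow_add_le {n : ℕ} (U V : unitaryGroup (Fin n) ℂ) (a b : Fin n → ℝ)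
    {t : ℝ} (ht : t ∈ Set.Ioo (1 / 2 : ℝ) 1) :
    frobeniusNorm' (sandwichCPow U V a b t + sandwichCPow V U b a t) ≤
      (2 : ℝ) ^ max (4 * t - 3) (0 : ℝ) *
        frobeniusNorm' (spectralCPow U a 1 + spectralCPow V b 1) := by
  obtain ⟨ht0, ht1⟩ := ht
  have hd := frobeniusNorm'_sandwichCPow_sq_le U V a b ht0.le ht1.le
  have hd' := frobeniusNorm'_sandwichCPow_sq_le V U b a ht0.le ht1.le
  have hA := isHermitian_spectralCPow U a 1
  have hB := isHermitian_spectralCPow V b 1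
  have htr : (spectralCPow U a 1 * spectralCPow V b 1).trace.re =
      frobeniusNorm' (spectralCPow U a (1 / 2 : ℝ) * spectralCPow V b (1 / 2 : ℝ)) ^ 2 := by
    have h1 : (1 : ℂ) = ((1 / 2 : ℝ) : ℂ) + ((1 / 2 : ℝ) : ℂ) := by push_cast; ring
    rw [← Complex.ofReal_re (frobeniusNorm' _ ^ 2),
      ← trace_conjTranspose_mul_self_eq_frobeniusNorm'_sq, conjTranspose_mul,
      (isHermitian_spectralCPow U a _).eq, (isHermitian_spectralCPow V b _).eq, h1,
      spectralCPow_add, spectralCPow_add, Matrix.mul_assoc (spectralCPow V b _), trace_mul_comm]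
    simp only [Matrix.mul_assoc]
    rw [trace_mul_comm (spectralCPow V b _)]
    simp only [Matrix.mul_assoc]
  have hsum := frobeniusNorm'_add_sq hA hB
  have hsum' := frobeniusNorm'_add_sq (isHermitian_sandwichCPow U V a b t)
    (isHermitian_sandwichCPow V U b a t)
  rw [Complex.ofReal_one, htr] at hsum
  have hre := Complex.re_le_norm (sandwichCPow U V a b t * sandwichCPow V U b a t).trace
  have h34 := fun z => norm_trace_sandwichCPow_le_of_re_eq_three_quarters U V a b (z := z)
  set p := frobeniusNorm' (spectralCPow U a (1 / 2 : ℝ) * spectralCPow V b (1 / 2 : ℝ)) ^ 2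
    with hp
  have hp0 : 0 ≤ p := sq_nonneg _
  have hn := frobeniusNorm'_nonneg (spectralCPow U a 1 + spectralCPow V b 1)
  rw [← sq_le_sq₀ (frobeniusNorm'_nonneg _) (by positivity), mul_pow, hsum, hsum']
  rcases le_or_gt t (3 / 4) with h | h
  · have hi := norm_trace_sandwichCPow_le_interp U V a b le_rfl (by norm_num) (by norm_num)
      ⟨ht0.le, h⟩ (fun z => norm_trace_sandwichCPow_le_of_re_eq_half U V a b (z := z)) h34
    rw [← hp, ← Real.rpow_add' hp0 (by simp)] at hi
    rw [max_eq_right (by linarith), Real.rpow_zero]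
    simp only [sub_add_cancel, Real.rpow_one] at hi
    linarith
  · have hi := norm_trace_sandwichCPow_le_interp U V a b (by norm_num) (by norm_num) le_rfl
      ⟨h.le, ht1.le⟩ h34 (fun z => norm_trace_sandwichCPow_le_of_re_eq_one U V a b (z := z))
    rw [show (t - 3 / 4) / (1 - 3 / 4) = 4 * t - 3 by ring] at hi
    rw [max_eq_left (by linarith)]
    have hx := frobeniusNorm'_nonneg (spectralCPow U a 1)
    have hy := frobeniusNorm'_nonneg (spectralCPow V b 1)
    generalize frobeniusNorm' (spectralCPow U a 1) = x at *
    generalize frobeniusNorm' (spectralCPow V b 1) = y at *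
    have hadd := add_rpow_mul_rpow_le (S := x ^ 2 + y ^ 2) (P := 2 * p) (θ := 4 * t - 3)
      (by positivity) (by positivity) (by linarith) (by linarith)
    have hle : 2 * (p ^ (1 - (4 * t - 3)) * (x * y) ^ (4 * t - 3)) ≤
        (2 * p) ^ (1 - (4 * t - 3)) * (x ^ 2 + y ^ 2) ^ (4 * t - 3) := by
      calc _ = (2 * p) ^ (1 - (4 * t - 3)) * (2 * (x * y)) ^ (4 * t - 3) := by
            rw [Real.mul_rpow zero_le_two hp0, Real.mul_rpow zero_le_two (by positivity),
              mul_mul_mul_comm, ← Real.rpow_add zero_lt_two]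
            simp
        _ ≤ _ := by
            gcongr
            · linarith
            · nlinarith [sq_nonneg (x - y)]
    linarith

lemma matRpow_eq_spectralCPow {n : ℕ} {A : Matrix (Fin n) (Fin n) ℂ} (hA : A.PosSemidef) {r : ℝ}
    (hr : r ≠ 0) : matRpow A r = spectralCPow hA.1.eigenvectorUnitary hA.1.eigenvalues r := by
  rw [matRpow, hA.1.cfc_eq, IsHermitian.cfc, Unitary.conjStarAlgAut_apply, spectralCPow]
  simp only [entireCPow_ofReal (hA.eigenvalues_nonneg _) hr]
  rfl

lemma spectralCPow_one_eq {n : ℕ} {A : Matrix (Fin n) (Fin n) ℂ} (hA : A.PosSemidef) :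
    spectralCPow hA.1.eigenvectorUnitary hA.1.eigenvalues 1 = A := by
  have h := matRpow_eq_spectralCPow hA one_ne_zero
  rw [Complex.ofReal_one] at h
  rw [← h, matRpow]
  simp only [Real.rpow_one]
  exact cfc_id' ℝ A hA.1

/-- **Interpolation estimate for the auxiliary expression `F_t`, Frobenius-norm case.**
For `n×n` positive semidefinite complex matrices `A, B` and `t ∈ (1/2, 1)`,
`‖B^(1-t) A^(2t-1) B^(1-t) + A^(1-t) B^(2t-1) A^(1-t)‖_F ≤ 2^(max (4t-3) 0) * ‖A + B‖_F`. -/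
theorem aux_ft_bound_frobenius {n : ℕ} (A B : Matrix (Fin n) (Fin n) ℂ)
    (hA : A.PosSemidef) (hB : B.PosSemidef) (t : ℝ)
    (ht : t ∈ Set.Ioo (1 / 2 : ℝ) 1) :
    frobeniusNorm' (matRpow B (1 - t) * matRpow A (2 * t - 1) * matRpow B (1 - t) +
        matRpow A (1 - t) * matRpow B (2 * t - 1) * matRpow A (1 - t)) ≤
      (2 : ℝ) ^ max (4 * t - 3) (0 : ℝ) * frobeniusNorm' (A + B) := by
  have h1 : 1 - t ≠ 0 := by linarith [ht.2]
  have h2 : 2 * t - 1 ≠ 0 := by linarith [ht.1]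
  have h := frobeniusNorm'_sandwichCPow_add_le hA.1.eigenvectorUnitary hB.1.eigenvectorUnitary
    hA.1.eigenvalues hB.1.eigenvalues ht
  rw [spectralCPow_one_eq hA, spectralCPow_one_eq hB] at h
  simpa [matRpow_eq_spectralCPow hA h1, matRpow_eq_spectralCPow hB h1,
    matRpow_eq_spectralCPow hA h2, matRpow_eq_spectralCPow hB h2, sandwichCPow] using h
end

section
/- Let 𝒜 be a unital C*-algebra, let a, b ∈ 𝒜 be positive elements, let z ∈ 𝒜 be arbitrary, and let t ∈ (0,1). Then ‖a^t z b^(1-t) + a^(1-t) z b^t‖ ≤ ‖a z + z b‖. -/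
open CStarMatrix in
lemma CStarMatrix.norm_offDiag_eq {A : Type*} [CStarAlgebra A] [PartialOrder A] [StarOrderedRing A]
    (x : A) :
    ‖(ofMatrix !![0, x; star x, 0] : CStarMatrix (Fin 2) (Fin 2) A)‖ = ‖x‖ := by
  apply le_antisymm
  · let φ : A × A →⋆ₙₐ[ℂ] CStarMatrix (Fin 2) (Fin 2) A :=
      { toFun := fun p => ofMatrix !![p.1, 0; 0, p.2]
        map_smul' := fun c p => by ext i j; fin_cases i <;> fin_cases j <;> simp
        map_zero' := by ext i j; fin_cases i <;> fin_cases j <;> simp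
        map_add' := fun p q => by ext i j; fin_cases i <;> fin_cases j <;> simp
        map_mul' := fun p q => by
          ext i j; fin_cases i <;> fin_cases j <;> simp [mul_apply]
        map_star' := fun p => by
          ext i j; fin_cases i <;> fin_cases j <;> simp [star_apply] }
    have h : star (ofMatrix !![0, x; star x, 0]) * ofMatrix !![0, x; star x, 0]
        = φ (x * star x, star x * x) := by
      ext i j; fin_cases i <;> fin_cases j <;> simp [φ, mul_apply, star_apply]
    have h2 := NonUnitalStarAlgHom.norm_apply_le φ (x * star x, star x * x)
    rw [← h, CStarRing.norm_star_mul_self, Prod.norm_def, CStarRing.norm_self_mul_star,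
      CStarRing.norm_star_mul_self, max_self] at h2
    exact (mul_self_le_mul_self_iff (norm_nonneg _) (norm_nonneg _)).2 h2
  · exact norm_entry_le_norm (M := ofMatrix !![0, x; star x, 0]) (i := 0) (j := 1)

lemma spectrum.two_mul_abs_le_norm_add_star {A : Type*} [CStarAlgebra A]
    {x : A} {l : ℝ} (hl : l ∈ spectrum ℝ x) : 2 * |l| ≤ ‖x + star x‖ := by
  have : Nontrivial A := by
    by_contra! h
    simp [spectrum.of_subsingleton] at hl
  have key (s : ℝ) : l ^ 2 + 2 * s * l ≤ ‖x‖ ^ 2 + |s| * ‖x + star x‖ := by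
    have h1 : l + s ∈ spectrum ℝ (x + algebraMap ℝ A s) := by
      rw [add_comm x]
      exact spectrum.add_mem_add_iff.2 hl
    have h2 : |l + s| ≤ ‖x + algebraMap ℝ A s‖ := by
      simpa using spectrum.norm_le_norm_of_mem h1
    have h3 : star (x + algebraMap ℝ A s) * (x + algebraMap ℝ A s)
        = star x * x + s • (x + star x) + algebraMap ℝ A (s ^ 2) := by
      simp only [Algebra.algebraMap_eq_smul_one, star_add, star_smul, star_one, add_mul, mul_add,
        smul_mul_assoc, mul_smul_comm, one_mul, mul_one, smul_add, pow_two, mul_smul, star_trivial]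
      abel
    have h4 : ‖x + algebraMap ℝ A s‖ * ‖x + algebraMap ℝ A s‖
        ≤ ‖x‖ ^ 2 + |s| * ‖x + star x‖ + s ^ 2 := by
      rw [← CStarRing.norm_star_mul_self, h3]
      refine norm_add₃_le.trans_eq ?_
      rw [CStarRing.norm_star_mul_self, norm_smul, norm_algebraMap', norm_pow, Real.norm_eq_abs,
        sq_abs, pow_two ‖x‖]
    have h5 := mul_self_le_mul_self (abs_nonneg _) h2
    rw [abs_mul_abs_self] at h5
    nlinarith
  by_contra! h
  set d := 2 * |l| - ‖x + star x‖ with hd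
  have hd0 : 0 < d := by linarith
  set r := (‖x‖ ^ 2 + 1) / d with hr
  have hrd : r * d = ‖x‖ ^ 2 + 1 := div_mul_cancel₀ _ hd0.ne'
  have hr0 : 0 < r := by positivity
  rcases abs_cases l with ⟨h0, -⟩ | ⟨h0, -⟩
  · have := key r
    rw [abs_of_pos hr0] at this
    rw [hd, h0] at hrd
    nlinarith [sq_nonneg l]
  · have := key (-r)
    rw [abs_neg, abs_of_pos hr0] at this
    rw [hd, h0] at hrd
    nlinarith [sq_nonneg l]

lemma IsSelfAdjoint.two_mul_norm_conj_le {A : Type*} [CStarAlgebra A] {p y : A}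
    (hp : IsSelfAdjoint p) (hy : IsSelfAdjoint y) :
    2 * ‖p * y * p‖ ≤ ‖p * p * y + y * (p * p)‖ := by
  nontriviality A
  have hs : IsSelfAdjoint (p * y * p) := by
    simp [IsSelfAdjoint, hp.star_eq, hy.star_eq, mul_assoc]
  obtain ⟨l, hl, hn⟩ : ∃ l ∈ spectrum ℝ (p * y * p), |l| = ‖p * y * p‖ := by
    rcases CStarAlgebra.norm_or_neg_norm_mem_spectrum hs with h | h
    · exact ⟨_, h, by simp⟩
    · exact ⟨_, h, by simp⟩
  rcases eq_or_ne l 0 with rfl | h0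
  · simp [← hn]
  · have h1 : l ∈ spectrum ℝ (p * p * y) := by
      have h2 : l ∈ spectrum ℝ (p * y * p) \ {0} := ⟨hl, h0⟩
      rw [spectrum.nonzero_mul_comm] at h2
      simpa [mul_assoc] using h2.1
    have := spectrum.two_mul_abs_le_norm_add_star h1
    simpa [hn, hp.star_eq, hy.star_eq] using this

open CStarMatrix in
/-- The operator-norm arithmetic-geometric mean inequality `2 ‖p y q‖ ≤ ‖p² y + y q²‖`. -/
lemma IsSelfAdjoint.two_mul_norm_mul_mul_le {A : Type*} [CStarAlgebra A] [PartialOrder A]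
    [StarOrderedRing A] {p q : A} (hp : IsSelfAdjoint p) (hq : IsSelfAdjoint q) (y : A) :
    2 * ‖p * y * q‖ ≤ ‖p * p * y + y * (q * q)‖ := by
  have hM : IsSelfAdjoint (ofMatrix !![p, 0; 0, q] : CStarMatrix (Fin 2) (Fin 2) A) := by
    ext i j; fin_cases i <;> fin_cases j <;> simp [star_apply, hp.star_eq, hq.star_eq]
  have hY : IsSelfAdjoint (ofMatrix !![0, y; star y, 0] : CStarMatrix (Fin 2) (Fin 2) A) := by
    ext i j; fin_cases i <;> fin_cases j <;> simp [star_apply]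
  have h := hM.two_mul_norm_conj_le hY
  convert h using 2
  · rw [← norm_offDiag_eq]
    congr 1
    ext i j; fin_cases i <;> fin_cases j <;>
      simp [mul_apply, hp.star_eq, hq.star_eq, mul_assoc]
  · rw [← norm_offDiag_eq]
    congr 1
    ext i j; fin_cases i <;> fin_cases j <;>
      simp [mul_apply, hp.star_eq, hq.star_eq, mul_assoc, add_comm]

lemma CFC.rpow_add_of_nonneg {A : Type*} [CStarAlgebra A] [PartialOrder A] [StarOrderedRing A]
    (a : A) {x y : ℝ} (hx : 0 ≤ x) (hy : 0 ≤ y) : a ^ (x + y) = a ^ x * a ^ y := by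
  simp only [CFC.rpow_def]
  rw [← cfc_mul _ _ a (NNReal.continuous_rpow_const hx).continuousOn
    (NNReal.continuous_rpow_const hy).continuousOn]
  exact cfc_congr fun z _ => NNReal.rpow_add_of_nonneg z hx hy

lemma CFC.norm_rpow_le_one_add_norm {A : Type*} [CStarAlgebra A] [PartialOrder A]
    [StarOrderedRing A] {a : A} (ha : 0 ≤ a) {t : ℝ} (ht : t ∈ Set.Ioo (0 : ℝ) 1) :
    ‖a ^ t‖ ≤ 1 + ‖a‖ := by
  rw [CFC.norm_rpow a ht.1 ha]
  calc ‖a‖ ^ t ≤ (1 + ‖a‖) ^ t := Real.rpow_le_rpow (norm_nonneg _) (by linarith) ht.1.le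
    _ ≤ (1 + ‖a‖) ^ (1 : ℝ) :=
      Real.rpow_le_rpow_of_exponent_le (by linarith [norm_nonneg a]) ht.2.le
    _ = 1 + ‖a‖ := Real.rpow_one _

/-- A bounded function, symmetric about `1 / 2`, which is midpoint convex along the triples
`0, t, 2 t`, is at most its value at the endpoint. -/
lemma le_of_forall_le_midpoint_two_mul {f : ℝ → ℝ} (hb : BddAbove (f '' Set.Ioo 0 1))
    (hsymm : ∀ t, f (1 - t) = f t)
    (hmid : ∀ t, 0 < t → t ≤ 1 / 2 → f t ≤ (f 1 + f (2 * t)) / 2)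
    {t : ℝ} (ht : t ∈ Set.Ioo (0 : ℝ) 1) : f t ≤ f 1 := by
  set S := sSup (f '' Set.Ioo 0 1)
  have hS : ∀ s ∈ Set.Ioo (0 : ℝ) 1, f s ≤ S := fun s hs => le_csSup hb ⟨s, hs, rfl⟩
  by_contra! h
  have hfS : f 1 < S := h.trans_le (hS t ht)
  have half : ∀ s, 0 < s → s ≤ 1 / 2 → f s ≤ (f 1 + S) / 2 := by
    intro s h0 h1
    refine (hmid s h0 h1).trans ?_
    rcases h1.eq_or_lt with rfl | h1
    · norm_num; linarith
    · linarith [hS (2 * s) ⟨by linarith, by linarith⟩]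
  have : S ≤ (f 1 + S) / 2 := by
    refine csSup_le ⟨f t, t, ht, rfl⟩ ?_
    rintro _ ⟨s, hs, rfl⟩
    rcases le_total s (1 / 2) with h1 | h1
    · exact half s hs.1 h1
    · rw [← hsymm]
      exact half (1 - s) (by linarith [hs.2]) (by linarith)
  linarith

/-- **Heinz-type inequality with an inserted element (operator-norm case).**
For positive elements `a, b` of a unital C*-algebra, any `z`, and `t ∈ (0,1)`,
`‖a^t z b^(1-t) + a^(1-t) z b^t‖ ≤ ‖a z + z b‖`, with real powers via the
continuous functional calculus. -/
theorem heinz_inequality_inserted_cstar {A : Type*} [CStarAlgebra A]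
    [PartialOrder A] [StarOrderedRing A]
    (a b z : A) (ha : 0 ≤ a) (hb : 0 ≤ b) (t : ℝ) (ht : t ∈ Set.Ioo (0 : ℝ) 1) :
    ‖CFC.rpow a t * z * CFC.rpow b (1 - t) + CFC.rpow a (1 - t) * z * CFC.rpow b t‖ ≤
      ‖a * z + z * b‖ := by
  simp only [CFC.rpow_eq_pow]
  let f : ℝ → ℝ := fun s => ‖a ^ s * z * b ^ (1 - s) + a ^ (1 - s) * z * b ^ s‖
  have hf1 : f 1 = ‖a * z + z * b‖ := by
    simp [f, CFC.rpow_one a ha, CFC.rpow_one b hb, CFC.rpow_zero a ha, CFC.rpow_zero b hb]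
  rw [← hf1]
  refine le_of_forall_le_midpoint_two_mul (f := f) ?_ (fun s => ?_) (fun s h0 h1 => ?_) ht
  · refine ⟨(1 + ‖a‖) * ‖z‖ * (1 + ‖b‖) + (1 + ‖a‖) * ‖z‖ * (1 + ‖b‖), ?_⟩
    rintro _ ⟨s, hs, rfl⟩
    have hs' : 1 - s ∈ Set.Ioo (0 : ℝ) 1 := ⟨by linarith [hs.2], by linarith [hs.1]⟩
    refine (norm_add_le _ _).trans (add_le_add ?_ ?_) <;>
    · refine (norm_mul₃_le).trans ?_
      gcongr <;> exact CFC.norm_rpow_le_one_add_norm ‹_› ‹_›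
  · simp [f, add_comm]
  · have h2 : 0 ≤ 1 - 2 * s := by linarith
    have key := (CFC.rpow_nonneg (a := a) (y := s)).isSelfAdjoint.two_mul_norm_mul_mul_le
      (CFC.rpow_nonneg (a := b) (y := s)).isSelfAdjoint
      (z * b ^ (1 - 2 * s) + a ^ (1 - 2 * s) * z)
    have e1 (c : A) : c ^ s * c ^ s = c ^ (2 * s) := by
      rw [← CFC.rpow_add_of_nonneg c h0.le h0.le, two_mul]
    have e2 (c : A) : c ^ s * c ^ (1 - 2 * s) = c ^ (1 - s) := by
      rw [← CFC.rpow_add_of_nonneg c h0.le h2]; ring_nf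
    have e3 (c : A) : c ^ (1 - 2 * s) * c ^ s = c ^ (1 - s) := by
      rw [← CFC.rpow_add_of_nonneg c h2 h0.le]; ring_nf
    have e4 (c : A) (hc : 0 ≤ c) : c ^ (2 * s) * c ^ (1 - 2 * s) = c := by
      rw [← CFC.rpow_add_of_nonneg c (by linarith) h2, add_sub_cancel, CFC.rpow_one c hc]
    have e5 (c : A) (hc : 0 ≤ c) : c ^ (1 - 2 * s) * c ^ (2 * s) = c := by
      rw [← CFC.rpow_add_of_nonneg c h2 (by linarith), sub_add_cancel, CFC.rpow_one c hc]
    have l1 : a ^ s * (z * b ^ (1 - 2 * s) + a ^ (1 - 2 * s) * z) * b ^ s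
        = a ^ s * z * b ^ (1 - s) + a ^ (1 - s) * z * b ^ s := by
      rw [← e3 b, ← e2 a]; noncomm_ring
    have l2 : a ^ s * a ^ s * (z * b ^ (1 - 2 * s) + a ^ (1 - 2 * s) * z)
          + (z * b ^ (1 - 2 * s) + a ^ (1 - 2 * s) * z) * (b ^ s * b ^ s)
        = (a * z + z * b)
          + (a ^ (2 * s) * z * b ^ (1 - 2 * s) + a ^ (1 - 2 * s) * z * b ^ (2 * s)) := by
      rw [e1, e1, mul_add, add_mul, ← mul_assoc (a ^ (2 * s)) (a ^ _), e4 a ha,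
        mul_assoc z (b ^ _), e5 b hb, ← mul_assoc (a ^ (2 * s)) z]
      abel
    rw [l1, l2] at key
    have := key.trans (norm_add_le _ _)
    rw [← hf1] at this
    linarith
end
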